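/- The Bernstein transform f of the fixed point measure μ, restricted to real s > 0, takes values in (0,∞) and satisfies: (i) f(1) = 1; (ii) the function s ↦ log(1/f(s)) is convex on (0,∞); (iii) f(s) = f(s+1) − 1/f(s+1) for all s > 0. -/

import Mathlib

open MeasureTheory Set

/-- The fixed point sequence. -/
noncomputable def fpSeq : ℕ → ℝ
  | 0 => 1
  | n + 1 => (-1 + Real.sqrt (1 + 4 * fpSeq n ^ 2)) / (2 * fpSeq n)

/-- The integrand `(1 - t^s)/(1 - t)`, extended continuously by the value `s` at `t = 1`. -/
noncomputable def bernKernelReal (s : ℝ) (t : ℝ) : ℝ :=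
  if t = 1 then s else (1 - t ^ s) / (1 - t)

/-- The Bernstein transform of `μ`, restricted to real arguments. -/
noncomputable def bernTransformReal (μ : Measure ℝ) (s : ℝ) : ℝ :=
  ∫ t in Set.Icc (0:ℝ) 1, bernKernelReal s t ∂μ

/-- Finite measures carried by `[0,1]` with equal moments integrate continuous functions
in the same way. -/
theorem integral_eq_of_moments_eq (ρ σ : Measure ℝ) [IsFiniteMeasure ρ] [IsFiniteMeasure σ]
    (hρ : ∀ᵐ x ∂ρ, x ∈ Icc (0:ℝ) 1) (hσ : ∀ᵐ x ∂σ, x ∈ Icc (0:ℝ) 1)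
    (h : ∀ n : ℕ, ∫ x, x ^ n ∂ρ = ∫ x, x ^ n ∂σ) (φ : ℝ → ℝ) (hφ : Continuous φ) :
    ∫ x, φ x ∂ρ = ∫ x, φ x ∂σ := by
  have hint : ∀ (τ : Measure ℝ) [IsFiniteMeasure τ], (∀ᵐ x ∂τ, x ∈ Icc (0:ℝ) 1) →
      ∀ ψ : ℝ → ℝ, Continuous ψ → Integrable ψ τ := by
    intro τ _ hτ ψ hψ
    obtain ⟨C, hC⟩ := isCompact_Icc.exists_bound_of_continuousOn (hψ.continuousOn (s := Icc 0 1))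
    exact Integrable.of_bound hψ.aestronglyMeasurable C (hτ.mono fun x hx => hC x hx)
  have hpoly : ∀ p : Polynomial ℝ, ∫ x, p.eval x ∂ρ = ∫ x, p.eval x ∂σ := by
    intro p
    simp only [Polynomial.eval_eq_sum_range]
    rw [integral_finsetSum _ fun i _ => hint ρ hρ _ (by fun_prop),
      integral_finsetSum _ fun i _ => hint σ hσ _ (by fun_prop)]
    simp only [integral_const_mul, h]
  have hclose : ∀ (τ : Measure ℝ) [IsFiniteMeasure τ], (∀ᵐ x ∂τ, x ∈ Icc (0:ℝ) 1) →
      ∀ (ε : ℝ) (p : Polynomial ℝ), (∀ x ∈ Icc (0:ℝ) 1, |p.eval x - φ x| < ε) →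
      |∫ x, p.eval x ∂τ - ∫ x, φ x ∂τ| ≤ ε * τ.real univ := by
    intro τ _ hτ ε p hp
    rw [← integral_sub (hint τ hτ _ p.continuous) (hint τ hτ _ hφ)]
    rw [← Real.norm_eq_abs]
    exact norm_integral_le_of_norm_le_const
      (hτ.mono fun x hx => (Real.norm_eq_abs _).trans_le (hp x hx).le)
  refine eq_of_abs_sub_le_all fun δ hδ => ?_
  set K := ρ.real univ + σ.real univ + 1
  have hK : 0 < K := by positivity
  obtain ⟨p, hp⟩ := exists_polynomial_near_of_continuousOn 0 1 φ hφ.continuousOn (δ / K)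
    (by positivity)
  have h1 := hclose ρ hρ _ p hp
  have h2 := hclose σ hσ _ p hp
  rw [hpoly] at h1
  have h3 : δ / K * ρ.real univ + δ / K * σ.real univ + δ / K = δ := by
    have : δ / K * K = δ := by field_simp
    linear_combination this
  have h4 : 0 < δ / K := by positivity
  rw [abs_le] at *
  constructor <;> linarith [h1.1, h1.2, h2.1, h2.2]

theorem fpSeq_pos (n : ℕ) : 0 < fpSeq n := by
  induction n with
  | zero => simp [fpSeq]
  | succ n ih =>
    rw [fpSeq]
    have : 1 < Real.sqrt (1 + 4 * fpSeq n ^ 2) := by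
      rw [Real.lt_sqrt (by norm_num)]
      nlinarith [pow_pos ih 2]
    apply div_pos <;> linarith

theorem fpSeq_succ_mul (n : ℕ) : fpSeq (n + 1) * (1 / fpSeq n + fpSeq (n + 1)) = 1 := by
  have h := fpSeq_pos n
  have hs := Real.sq_sqrt (show 0 ≤ 1 + 4 * fpSeq n ^ 2 by positivity)
  rw [fpSeq]
  field_simp
  nlinarith

theorem bernKernelReal_add_one_sub (s t : ℝ) (hs : 0 < s) (ht : 0 ≤ t) :
    bernKernelReal (s + 1) t - bernKernelReal s t = t ^ s := by
  unfold bernKernelReal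
  split_ifs with h
  · simp [h]
  · have : 1 - t ≠ 0 := sub_ne_zero.2 (Ne.symm h)
    rw [Real.rpow_add_one' ht (by linarith)]
    field_simp
    ring

theorem bernKernelReal_le (s t : ℝ) (hs : 0 < s) (ht : t ∈ Icc (0:ℝ) 1) :
    bernKernelReal s t ≤ max 1 s := by
  unfold bernKernelReal
  split_ifs with h
  · exact le_max_right _ _
  · have h1 : 0 < 1 - t := sub_pos.2 (lt_of_le_of_ne ht.2 h)
    rw [div_le_iff₀ h1]
    rcases le_total 1 s with h' | h'
    · have := one_add_mul_self_le_rpow_one_add (s := t - 1) (by linarith [ht.1]) h'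
      rw [max_eq_right h']
      rw [add_sub_cancel] at this
      linarith
    · rw [max_eq_left h']
      have := Real.rpow_le_rpow_of_exponent_ge' ht.1 ht.2 hs.le h'
      rw [Real.rpow_one] at this
      linarith

theorem le_bernKernelReal (s t : ℝ) (hs : 0 < s) (ht : t ∈ Icc (0:ℝ) 1) :
    min 1 s ≤ bernKernelReal s t := by
  unfold bernKernelReal
  split_ifs with h
  · exact min_le_right _ _
  · have h1 : 0 < 1 - t := sub_pos.2 (lt_of_le_of_ne ht.2 h)
    rw [le_div_iff₀ h1]
    rcases le_total 1 s with h' | h'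
    · rw [min_eq_left h']
      have := Real.rpow_le_rpow_of_exponent_ge' ht.1 ht.2 zero_le_one h'
      rw [Real.rpow_one] at this
      linarith
    · have := rpow_one_add_le_one_add_mul_self (s := t - 1) (by linarith [ht.1]) hs.le h'
      rw [min_eq_right h']
      rw [add_sub_cancel] at this
      linarith

theorem measurable_bernKernelReal (s : ℝ) : Measurable (bernKernelReal s) := by
  unfold bernKernelReal
  exact Measurable.ite (measurableSet_singleton 1) measurable_const (by fun_prop)

theorem integrableOn_bernKernelReal (μ : Measure ℝ) [IsFiniteMeasure μ] (s : ℝ) (hs : 0 < s) :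
    IntegrableOn (bernKernelReal s) (Icc 0 1) μ := by
  refine Integrable.of_bound (measurable_bernKernelReal s).aestronglyMeasurable (max 1 s) ?_
  refine (ae_restrict_mem measurableSet_Icc).mono fun t ht => ?_
  rw [Real.norm_eq_abs, abs_of_nonneg]
  · exact bernKernelReal_le s t hs ht
  · exact (le_min zero_le_one hs.le).trans (le_bernKernelReal s t hs ht)

theorem concaveOn_bernKernelReal (t : ℝ) (ht : t ∈ Icc (0:ℝ) 1) :
    ConcaveOn ℝ (Ioi (0:ℝ)) fun s => bernKernelReal s t := by
  have hconv : ConvexOn ℝ (Ioi (0:ℝ)) fun s => t ^ s := by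
    rcases ht.1.eq_or_lt with rfl | h
    · refine (convexOn_const 0 (convex_Ioi 0)).congr fun s hs => ?_
      exact (Real.zero_rpow (ne_of_gt hs)).symm
    · exact (convexOn_rpow_left h).subset (subset_univ _) (convex_Ioi 0)
  refine ⟨convex_Ioi 0, fun x hx y hy a b ha hb hab => ?_⟩
  have := hconv.2 hx hy ha hb hab
  simp only [smul_eq_mul, bernKernelReal] at *
  split_ifs with h
  · rfl
  · have h1 : 0 < 1 - t := sub_pos.2 (lt_of_le_of_ne ht.2 h)
    rw [mul_div_assoc', mul_div_assoc', ← add_div]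
    gcongr
    linarith

/-- The kernel as a power moment of the uniform distribution on `[t, 1]`. -/
theorem integral_affine_rpow (s t : ℝ) (hs : 0 ≤ s) :
    ∫ w in (0:ℝ)..1, (t + (1 - t) * w) ^ s = bernKernelReal (s + 1) t / (s + 1) := by
  unfold bernKernelReal
  split_ifs with h
  · have : s + 1 ≠ 0 := by positivity
    simp [h, this]
  · have h1 : 1 - t ≠ 0 := sub_ne_zero.2 (Ne.symm h)
    rw [intervalIntegral.integral_comp_add_mul (fun x => x ^ s) h1,
      integral_rpow (Or.inl (by linarith))]
    simp only [mul_zero, add_zero, mul_one, add_sub_cancel, Real.one_rpow, smul_eq_mul]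
    field_simp

theorem concaveOn_bernTransformReal (μ : Measure ℝ) [IsFiniteMeasure μ] :
    ConcaveOn ℝ (Ioi (0:ℝ)) (bernTransformReal μ) := by
  refine ⟨convex_Ioi 0, fun x hx y hy a b ha hb hab => ?_⟩
  have hx' := integrableOn_bernKernelReal μ x hx
  have hy' := integrableOn_bernKernelReal μ y hy
  simp only [smul_eq_mul, bernTransformReal]
  rw [← integral_const_mul, ← integral_const_mul,
    ← integral_add (hx'.const_mul a) (hy'.const_mul b)]
  refine setIntegral_mono_on ((hx'.const_mul a).add (hy'.const_mul b))
    (integrableOn_bernKernelReal μ _ (convex_Ioi (0:ℝ) hx hy ha hb hab)) measurableSet_Icc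
    fun t ht => ?_
  exact (concaveOn_bernKernelReal t ht).2 hx hy ha hb hab

theorem bernTransformReal_add_one_sub (μ : Measure ℝ) [IsFiniteMeasure μ] (s : ℝ) (hs : 0 < s) :
    bernTransformReal μ (s + 1) - bernTransformReal μ s = ∫ t in Icc (0:ℝ) 1, t ^ s ∂μ := by
  unfold bernTransformReal
  rw [← integral_sub (integrableOn_bernKernelReal μ _ (by linarith))
    (integrableOn_bernKernelReal μ s hs)]
  exact setIntegral_congr_fun measurableSet_Icc fun t ht =>
    bernKernelReal_add_one_sub s t hs ht.1

/-- The law of `T * (U + (1 - U) * W)` for independent `T, U ∼ μ` and `W` uniform on `[0,1]`. -/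
noncomputable def mellinProductLaw (μ : Measure ℝ) : Measure ℝ :=
  ((μ.restrict (Icc 0 1)).prod ((μ.restrict (Icc 0 1)).prod
    ((volume : Measure ℝ).restrict (Icc 0 1)))).map
    fun x => x.1 * (x.2.1 + (1 - x.2.1) * x.2.2)

instance (μ : Measure ℝ) [IsFiniteMeasure μ] : IsFiniteMeasure (mellinProductLaw μ) := by
  unfold mellinProductLaw; infer_instance

theorem ae_mem_prod_Icc (μ : Measure ℝ) [IsFiniteMeasure μ] :
    ∀ᵐ x ∂((μ.restrict (Icc 0 1)).prod ((μ.restrict (Icc 0 1)).prod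
      ((volume : Measure ℝ).restrict (Icc 0 1)))),
      x.1 ∈ Icc (0:ℝ) 1 ∧ x.2.1 ∈ Icc (0:ℝ) 1 ∧ x.2.2 ∈ Icc (0:ℝ) 1 := by
  rw [Measure.prod_restrict, Measure.prod_restrict]
  exact ae_restrict_mem (measurableSet_Icc.prod (measurableSet_Icc.prod measurableSet_Icc))

theorem ae_mellinProductLaw_mem_Icc (μ : Measure ℝ) [IsFiniteMeasure μ] :
    ∀ᵐ x ∂mellinProductLaw μ, x ∈ Icc (0:ℝ) 1 := by
  rw [mellinProductLaw]
  refine (ae_map_iff (by fun_prop) measurableSet_Icc).2 ?_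
  filter_upwards [ae_mem_prod_Icc μ] with x ⟨h1, h2, h3⟩
  have h4 : 0 ≤ (1 - x.2.1) * x.2.2 := mul_nonneg (by linarith [h2.2]) h3.1
  have h5 : (1 - x.2.1) * x.2.2 ≤ 1 - x.2.1 :=
    mul_le_of_le_one_right (by linarith [h2.2]) h3.2
  exact ⟨mul_nonneg h1.1 (by linarith [h2.1]),
    mul_le_one₀ h1.2 (by linarith [h2.1]) (by linarith)⟩

theorem integral_rpow_mellinProductLaw (μ : Measure ℝ) [IsFiniteMeasure μ] (s : ℝ) (hs : 0 ≤ s) :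
    ∫ x, x ^ s ∂mellinProductLaw μ =
      (∫ t in Icc (0:ℝ) 1, t ^ s ∂μ) * (bernTransformReal μ (s + 1) / (s + 1)) := by
  have hcont : Continuous fun x : ℝ => x ^ s := Real.continuous_rpow_const hs
  rw [mellinProductLaw, integral_map (by fun_prop) hcont.aestronglyMeasurable]
  have hsplit : ∀ᵐ x ∂((μ.restrict (Icc 0 1)).prod ((μ.restrict (Icc 0 1)).prod
      ((volume : Measure ℝ).restrict (Icc 0 1)))),
      (x.1 * (x.2.1 + (1 - x.2.1) * x.2.2)) ^ s =
        x.1 ^ s * (x.2.1 + (1 - x.2.1) * x.2.2) ^ s := by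
    filter_upwards [ae_mem_prod_Icc μ] with x ⟨h1, h2, h3⟩
    exact Real.mul_rpow h1.1
      (add_nonneg h2.1 (mul_nonneg (by linarith [h2.2]) h3.1))
  rw [integral_congr_ae hsplit, integral_prod_mul (fun t : ℝ => t ^ s)
    (fun y : ℝ × ℝ => (y.1 + (1 - y.1) * y.2) ^ s)]
  congr 1
  have hint : Integrable (fun y : ℝ × ℝ => (y.1 + (1 - y.1) * y.2) ^ s)
      ((μ.restrict (Icc 0 1)).prod ((volume : Measure ℝ).restrict (Icc 0 1))) := by
    rw [Measure.prod_restrict]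
    exact (hcont.comp (by fun_prop : Continuous fun y : ℝ × ℝ => y.1 + (1 - y.1) * y.2)
      ).continuousOn.integrableOn_compact (isCompact_Icc.prod isCompact_Icc)
  rw [integral_prod _ hint, bernTransformReal, ← integral_div]
  refine integral_congr_ae (Filter.Eventually.of_forall fun u => ?_)
  simp only
  rw [integral_Icc_eq_integral_Ioc, ← intervalIntegral.integral_of_le zero_le_one,
    integral_affine_rpow s u hs]

theorem bernTransformReal_one (μ : Measure ℝ)
    (hmom : ∀ n : ℕ, ∫ t in Icc (0:ℝ) 1, t ^ n ∂μ = fpSeq n) : bernTransformReal μ 1 = 1 := by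
  have h : ∀ t : ℝ, bernKernelReal 1 t = t ^ 0 := by
    intro t
    unfold bernKernelReal
    split_ifs with h
    · simp
    · rw [Real.rpow_one, div_self (sub_ne_zero.2 (Ne.symm h)), pow_zero]
  simp only [bernTransformReal, h, hmom, fpSeq]

theorem fpSeq_mul_bernTransformReal (μ : Measure ℝ) [IsFiniteMeasure μ]
    (hmom : ∀ n : ℕ, ∫ t in Icc (0:ℝ) 1, t ^ n ∂μ = fpSeq n) (n : ℕ) :
    fpSeq n * bernTransformReal μ (n + 1) = 1 := by
  induction n with
  | zero => simp [fpSeq, bernTransformReal_one μ hmom]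
  | succ n ih =>
    have h := bernTransformReal_add_one_sub μ ((n + 1 : ℕ) : ℝ) (by positivity)
    simp only [Real.rpow_natCast, hmom] at h
    have h2 : bernTransformReal μ ((n + 1 : ℕ) : ℝ) = 1 / fpSeq n := by
      rw [eq_div_iff (fpSeq_pos n).ne', mul_comm]
      exact_mod_cast ih
    rw [show bernTransformReal μ (((n + 1 : ℕ) : ℝ) + 1) = 1 / fpSeq n + fpSeq (n + 1) by linarith]
    exact fpSeq_succ_mul n

theorem integral_rpow_mul_bernTransformReal (μ : Measure ℝ) [IsFiniteMeasure μ]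
    (hmom : ∀ n : ℕ, ∫ t in Icc (0:ℝ) 1, t ^ n ∂μ = fpSeq n) (s : ℝ) (hs : 0 ≤ s) :
    (∫ t in Icc (0:ℝ) 1, t ^ s ∂μ) * bernTransformReal μ (s + 1) = 1 := by
  have huniform : ∀ r : ℝ, 0 ≤ r → ∫ x in Icc (0:ℝ) 1, x ^ r = 1 / (r + 1) := by
    intro r hr
    rw [integral_Icc_eq_integral_Ioc, ← intervalIntegral.integral_of_le zero_le_one,
      integral_rpow (Or.inl (by linarith)), Real.one_rpow, Real.zero_rpow (by linarith), sub_zero]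
  have key := integral_eq_of_moments_eq (mellinProductLaw μ) (volume.restrict (Icc 0 1))
    (ae_mellinProductLaw_mem_Icc μ) (ae_restrict_mem measurableSet_Icc) (fun n => by
      simp only [← Real.rpow_natCast]
      rw [integral_rpow_mellinProductLaw μ n n.cast_nonneg, huniform n n.cast_nonneg]
      simp only [Real.rpow_natCast, hmom]
      rw [mul_div_assoc', fpSeq_mul_bernTransformReal μ hmom n])
    (fun x => x ^ s) (Real.continuous_rpow_const hs)
  rw [integral_rpow_mellinProductLaw μ s hs, huniform s hs, mul_div_assoc'] at key
  have : s + 1 ≠ 0 := by positivity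
  field_simp at key
  exact key

theorem stmt_4 (μ : Measure ℝ) [IsProbabilityMeasure μ]
    (hsupp : μ (Set.Icc (0:ℝ) 1)ᶜ = 0) (h0 : μ {0} = 0)
    (hmom : ∀ n : ℕ, ∫ t in Set.Icc (0:ℝ) 1, t ^ n ∂μ = fpSeq n) :
    (∀ s : ℝ, 0 < s → 0 < bernTransformReal μ s) ∧
    bernTransformReal μ 1 = 1 ∧
    ConvexOn ℝ (Set.Ioi (0:ℝ)) (fun s => Real.log (1 / bernTransformReal μ s)) ∧
    ∀ s : ℝ, 0 < s →
      bernTransformReal μ s =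
        bernTransformReal μ (s + 1) - 1 / bernTransformReal μ (s + 1) := by
  have hpos : ∀ s : ℝ, 0 < s → 0 < bernTransformReal μ s := by
    intro s hs
    have hmin : 0 < min 1 s := lt_min one_pos hs
    have hmass : ∫ _t in Icc (0:ℝ) 1, min 1 s ∂μ = min 1 s := by
      have h := hmom 0
      simp only [pow_zero, fpSeq] at h
      rw [← mul_one (min 1 s), integral_const_mul, h]
    calc 0 < ∫ _t in Icc (0:ℝ) 1, min 1 s ∂μ := by rwa [hmass]
      _ ≤ bernTransformReal μ s :=
        setIntegral_mono_on (integrable_const _) (integrableOn_bernKernelReal μ s hs)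
          measurableSet_Icc fun t ht => le_bernKernelReal s t hs ht
  refine ⟨hpos, bernTransformReal_one μ hmom, ?_, fun s hs => ?_⟩
  · have hconc := concaveOn_bernTransformReal μ
    refine ⟨convex_Ioi 0, fun x hx y hy a b ha hb hab => ?_⟩
    have hfx := hpos x hx
    have hfy := hpos y hy
    have hlog := strictConcaveOn_log_Ioi.concaveOn.2 hfx hfy ha hb hab
    have hmono := Real.log_le_log (convex_Ioi (0:ℝ) hfx hfy ha hb hab)
      (hconc.2 hx hy ha hb hab)
    simp only [one_div, Real.log_inv, smul_eq_mul] at *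
    linarith
  · have h1 := bernTransformReal_add_one_sub μ s hs
    have h2 := integral_rpow_mul_bernTransformReal μ hmom s hs.le
    rw [← eq_div_iff (hpos (s + 1) (by linarith)).ne'] at h2
    linarith
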